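/- arXiv:2404.08102 — 2 statements merged into one kernel-verified Lean document; each statement's English description precedes it below -/
import Mathlib

section
/- Let a, b, d, n be integers with a ≥ 2, b ≥ 2, d ≥ 1, n ≥ 0, and (d, n) ≠ (1, 0). Then, as rational numbers, ((a + b)d − 2 + an)/(ab − 1) − d/a − n ≤ d − 1. -/
/-- The inequality of `stmt_2` after clearing the denominators `a` and `a * b - 1`. -/
lemma cleared_numerator_nonneg {a b d n : ℤ} (ha : 2 ≤ a) (hb : 2 ≤ b) (hn : 0 ≤ n)
    (hm : 2 ≤ d + n) :
    0 ≤ (d + n - 1) * (a * (a * b - 1)) - (a ^ 2 * (d + n) + d - 2 * a) := by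
  have h₁ : 0 ≤ a ^ 2 * ((b - 2) * (d + n - 1)) :=
    mul_nonneg (sq_nonneg a) (mul_nonneg (by linarith) (by linarith))
  have h₂ : 0 ≤ (d + n - 2) * (a ^ 2 - a - 1) := mul_nonneg (by linarith) (by nlinarith)
  linarith


/-- Lemma 5.3, first inequality: for integers `a, b ≥ 2`, `d ≥ 1`, `n ≥ 0` with
`(d, n) ≠ (1, 0)`, we have `((a+b)d - 2 + an)/(ab - 1) - d/a - n ≤ d - 1` in `ℚ`. -/
theorem stmt_2 (a b d n : ℤ) (ha : 2 ≤ a) (hb : 2 ≤ b) (hd : 1 ≤ d) (hn : 0 ≤ n)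
    (hdn : ¬(d = 1 ∧ n = 0)) :
    ((a + b) * d - 2 + a * n : ℚ) / (a * b - 1) - (d : ℚ) / a - n ≤ d - 1 := by
  have hm : 2 ≤ d + n := by lia
  have key : (0 : ℚ) ≤ (d + n - 1) * (a * (a * b - 1)) - (a ^ 2 * (d + n) + d - 2 * a) := by
    exact_mod_cast cleared_numerator_nonneg ha hb hn hm
  have ha' : (0 : ℚ) < a := by exact_mod_cast (by linarith : 0 < a)
  have hab : (0 : ℚ) < a * b - 1 := by exact_mod_cast (by nlinarith : 0 < a * b - 1)
  have hsub : (d - 1 : ℚ) - (((a + b) * d - 2 + a * n) / (a * b - 1) - d / a - n) =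
      ((d + n - 1) * (a * (a * b - 1)) - (a ^ 2 * (d + n) + d - 2 * a)) /
        (a * (a * b - 1)) := by
    field_simp [ha'.ne', hab.ne']
    ring
  rw [← sub_nonneg, hsub]
  exact div_nonneg key (mul_pos ha' hab).le
end

section
/- Let a, b, d, n be integers with a ≥ 2, b ≥ 2, d ≥ 1, n ≥ 0, and suppose a(d + n) ≤ bd + abn (equivalently, (d + n)/b ≤ d/a + n as rationals). Assume furthermore that it is NOT the case that (n = 0 and a = b and d ≤ a − 1), and NOT the case that (n = 1 and 3b ≤ a + 1 and (a − b)d = a(b − 1)). Then [(b − a)(ab − a − 1) + 2]d + (a²(b − 1)² − ab + 2a)n ≥ 2a. -/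
/-- Proof of the main theorem, middle case: the integer inequality (eq:single_ineq)
holds for all `a, b ≥ 2`, `d ≥ 1`, `n ≥ 0` with `(d+n)/b ≤ d/a + n` (in integer form
`a(d+n) ≤ bd + abn`), outside of the two exceptional families. -/
theorem stmt_8 (a b d n : ℤ) (ha : 2 ≤ a) (hb : 2 ≤ b) (hd : 1 ≤ d) (hn : 0 ≤ n)
    (hslope : a * (d + n) ≤ b * d + a * b * n)
    (hexc1 : ¬(n = 0 ∧ a = b ∧ d ≤ a - 1))
    (hexc2 : ¬(n = 1 ∧ 3 * b ≤ a + 1 ∧ (a - b) * d = a * (b - 1))) :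
    ((b - a) * (a * b - a - 1) + 2) * d + (a ^ 2 * (b - 1) ^ 2 - a * b + 2 * a) * n
      ≥ 2 * a := by
  obtain ⟨s, hs⟩ : ∃ s, s = a * (b - 1) * n - (a - b) * d := ⟨_, rfl⟩
  have hs0 : 0 ≤ s := by linarith
  have hc : a ≤ a * (b - 1) := by nlinarith
  have key : ((b - a) * (a * b - a - 1) + 2) * d + (a ^ 2 * (b - 1) ^ 2 - a * b + 2 * a) * n
      = (a * (b - 1) - 1) * s + 2 * d + a * n := by rw [hs]; ring
  rw [key]
  have hcs : 0 ≤ (a * (b - 1) - 1) * s := mul_nonneg (by linarith) hs0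
  obtain hn2 | rfl | rfl : 2 ≤ n ∨ n = 1 ∨ n = 0 := by omega
  · nlinarith
  · obtain hs1 | rfl : 1 ≤ s ∨ s = 0 := by omega
    · nlinarith
    · have hd' : (a - b) * d = a * (b - 1) := by linarith
      have h3 : a + 2 ≤ 3 * b := by
        by_contra! h
        exact hexc2 ⟨rfl, by omega, hd'⟩
      have hab : 0 < a - b := pos_of_mul_pos_left (by linarith : 0 < (a - b) * d) (by linarith)
      have hmul : (a - b) * a ≤ (a - b) * (2 * d) := by nlinarith
      have : a ≤ 2 * d := le_of_mul_le_mul_left hmul hab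
      linarith
  · have hsd : s = (b - a) * d := by rw [hs]; ring
    have hab : a ≤ b := by
      by_contra! h
      nlinarith
    obtain rfl | hlt := hab.eq_or_lt
    · have : a ≤ d := by
        by_contra! h
        exact hexc1 ⟨rfl, rfl, by omega⟩
      linarith
    · have hs1 : 1 ≤ s := by nlinarith
      have hcc : 2 * a ≤ a * (b - 1) := by nlinarith
      nlinarith
end
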